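/- arXiv:2008.04466 — 2 statements merged into one kernel-verified Lean document; each statement's English description precedes it below -/
import Mathlib

section
/- Let μ be a non-atomic, σ-finite measure on (T, Σ). If {α_m}_{m≥1} is a sequence of positive real numbers and {u_m}_{m≥1} is a sequence of finite-valued, non-negative, measurable functions on T such that ∫_T u_m dμ ≥ 2^m · α_m for all m ≥ 1, then there exist a strictly increasing sequence {m_n} of natural numbers and a sequence {A_n} of pairwise disjoint measurable sets such that ∫_{A_n} u_{m_n} dμ = α_{m_n} for all n ≥ 1. -/
open MeasureTheory Filter Set

open scoped ENNReal

/-- Small subsets of positive measure. -/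
lemma aux_small {T : Type*} [MeasurableSpace T] (ν : Measure T) [SigmaFinite ν]
    (hna : ∀ A : Set T, MeasurableSet A → 0 < ν A →
      ∃ B ⊆ A, MeasurableSet B ∧ 0 < ν B ∧ 0 < ν (A \ B))
    (A : Set T) (hA : MeasurableSet A) (hpos : 0 < ν A) (ε : ℝ≥0∞) (hε : ε ≠ 0) :
    ∃ B ⊆ A, MeasurableSet B ∧ 0 < ν B ∧ ν B < ε := by
  obtain ⟨A0, hA0, hsub, hp0, hfin⟩ := Measure.exists_subset_measure_lt_top hA hpos
  have key : ∀ n : ℕ, ∃ B ⊆ A0, MeasurableSet B ∧ 0 < ν B ∧ 2 ^ n * ν B ≤ ν A0 := by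
    intro n
    induction n with
    | zero => exact ⟨A0, Subset.rfl, hA0, hp0, by simp⟩
    | succ n ih =>
      obtain ⟨B, hB, hBm, hBp, hBle⟩ := ih
      obtain ⟨C, hC, hCm, hCp, hCp'⟩ := hna B hBm hBp
      have hsum : ν C + ν (B \ C) = ν B := by
        have := measure_inter_add_sdiff (μ := ν) B hCm
        rwa [inter_eq_self_of_subset_right hC] at this
      rcases le_total (ν C) (ν (B \ C)) with h | h
      · refine ⟨C, hC.trans hB, hCm, hCp, le_trans ?_ hBle⟩
        rw [pow_succ, mul_assoc, two_mul (ν C), ← hsum]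
        gcongr
      · refine ⟨B \ C, sdiff_subset.trans hB, hBm.diff hCm, hCp', le_trans ?_ hBle⟩
        rw [pow_succ, mul_assoc, two_mul (ν (B \ C)), ← hsum]
        gcongr
  obtain ⟨n, hn⟩ := ENNReal.exists_nat_mul_gt hε hfin.ne
  obtain ⟨B, hB, hBm, hBp, hBle⟩ := key n
  refine ⟨B, hB.trans hsub, hBm, hBp, ?_⟩
  by_contra hcon
  push Not at hcon
  have h1 : (n : ℝ≥0∞) ≤ 2 ^ n := by exact_mod_cast n.lt_two_pow_self.le
  have h2 : (n : ℝ≥0∞) * ε ≤ 2 ^ n * ν B := by gcongr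
  exact absurd (h2.trans hBle) (not_le.mpr hn)

/-- Sierpinski's theorem for non-atomic sigma-finite measures. -/
lemma aux_sierp {T : Type*} [MeasurableSpace T] (ν : Measure T) [SigmaFinite ν]
    (hna : ∀ A : Set T, MeasurableSet A → 0 < ν A →
      ∃ B ⊆ A, MeasurableSet B ∧ 0 < ν B ∧ 0 < ν (A \ B))
    (A : Set T) (hA : MeasurableSet A) (c : ℝ≥0∞) (hc : c ≠ ∞) (hcA : c ≤ ν A) :
    ∃ B ⊆ A, MeasurableSet B ∧ ν B = c := by
  let S := {B : Set T // B ⊆ A ∧ MeasurableSet B ∧ ν B ≤ c}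
  have step : ∀ (n : ℕ) (B : S), ∃ D : S, B.1 ⊆ D.1 ∧
      ∀ D' : S, B.1 ⊆ D'.1 → ν D'.1 ≤ ν D.1 + ((n : ℝ≥0∞) + 1)⁻¹ := by
    intro n B
    by_contra hcon
    push Not at hcon
    have hε : ((n : ℝ≥0∞) + 1)⁻¹ ≠ 0 := by simp
    have hk : ∀ k : ℕ, ∃ D : S, B.1 ⊆ D.1 ∧ (k : ℝ≥0∞) * ((n : ℝ≥0∞) + 1)⁻¹ ≤ ν D.1 := by
      intro k
      induction k with
      | zero => exact ⟨B, Subset.rfl, by simp⟩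
      | succ k ih =>
        obtain ⟨D, hD, hDk⟩ := ih
        obtain ⟨D', hD', hlt⟩ := hcon D hD
        refine ⟨D', hD', le_trans ?_ hlt.le⟩
        push_cast
        rw [add_mul, one_mul]
        gcongr
    obtain ⟨k, hk'⟩ := ENNReal.exists_nat_mul_gt hε hc
    obtain ⟨D, -, hD⟩ := hk k
    exact absurd (hD.trans D.2.2.2) (not_le.mpr hk')
  choose f hf1 hf2 using step
  let s : ℕ → S := fun n => Nat.rec ⟨∅, by simp⟩ (fun n B => f n B) n
  have hs : ∀ n, s (n + 1) = f n (s n) := fun n => rfl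
  have hmono : Monotone (fun n => (s n).1) := by
    apply monotone_nat_of_le_succ
    intro n
    rw [hs]
    exact hf1 n (s n)
  have hUm : MeasurableSet (⋃ n, (s n).1) := MeasurableSet.iUnion fun n => (s n).2.2.1
  have hUA : (⋃ n, (s n).1) ⊆ A := iUnion_subset fun n => (s n).2.1
  have hUc : ν (⋃ n, (s n).1) ≤ c := by
    rw [hmono.measure_iUnion]
    exact iSup_le fun n => (s n).2.2.2
  refine ⟨_, hUA, hUm, ?_⟩
  set U := ⋃ n, (s n).1 with hU
  by_contra hne
  have hlt : ν U < c := lt_of_le_of_ne hUc hne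
  have hUfin : ν U ≠ ∞ := (hlt.trans_le le_top).ne
  have hdiff : 0 < ν (A \ U) := by
    rw [measure_sdiff hUA hUm.nullMeasurableSet hUfin]
    exact tsub_pos_of_lt (hlt.trans_le hcA)
  obtain ⟨C, hC, hCm, hCp, hClt⟩ := aux_small ν hna (A \ U) (hA.diff hUm) hdiff (c - ν U)
    (tsub_pos_of_lt hlt).ne'
  have hdisj : Disjoint U C := disjoint_sdiff_right.mono_right hC
  have hUC : ν (U ∪ C) = ν U + ν C := measure_union hdisj hCm
  have hle : ν (U ∪ C) ≤ c := by
    rw [hUC]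
    calc ν U + ν C ≤ ν U + (c - ν U) := by gcongr
      _ = c := add_tsub_cancel_of_le hUc
  have hbd : ∀ n : ℕ, ν C ≤ ((n : ℝ≥0∞) + 1)⁻¹ := by
    intro n
    have h1 := hf2 n (s n) ⟨U ∪ C, union_subset hUA (hC.trans sdiff_subset), hUm.union hCm, hle⟩
      ((subset_iUnion (fun n => (s n).1) n).trans subset_union_left)
    rw [← hs] at h1
    have h2 : ν (s (n + 1)).1 ≤ ν U := measure_mono (subset_iUnion (fun n => (s n).1) (n + 1))
    have h3 : ν U + ν C ≤ ν U + ((n : ℝ≥0∞) + 1)⁻¹ := by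
      rw [← hUC]
      exact h1.trans (by gcongr)
    exact (ENNReal.add_le_add_iff_left hUfin).1 h3
  obtain ⟨n, hn⟩ := ENNReal.exists_inv_nat_lt hCp.ne'
  have h4 : ((n : ℝ≥0∞) + 1)⁻¹ ≤ (n : ℝ≥0∞)⁻¹ := ENNReal.inv_le_inv.2 le_self_add
  exact absurd ((hbd n).trans h4) (not_le.mpr hn)

/-- Subsets with prescribed integral. -/
lemma aux_integral {T : Type*} [MeasurableSpace T] (μ : Measure T) [SigmaFinite μ]
    (hna : ∀ A : Set T, MeasurableSet A → 0 < μ A →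
      ∃ B ⊆ A, MeasurableSet B ∧ 0 < μ B ∧ μ B < μ A)
    (u : T → ℝ) (hu : Measurable u) (A : Set T) (hA : MeasurableSet A)
    (c : ℝ≥0∞) (hc : c ≠ ∞) (hcA : c ≤ ∫⁻ t in A, ENNReal.ofReal (u t) ∂μ) :
    ∃ B ⊆ A, MeasurableSet B ∧ ∫⁻ t in B, ENNReal.ofReal (u t) ∂μ = c := by
  have hum : Measurable fun t => ENNReal.ofReal (u t) := hu.ennreal_ofReal
  obtain ⟨ν, hν⟩ : ∃ ν : Measure T, ν = μ.withDensity fun t => ENNReal.ofReal (u t) := ⟨_, rfl⟩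
  have hsf : SigmaFinite ν := by
    rw [hν]
    exact SigmaFinite.withDensity_ofReal u
  have happ : ∀ s, MeasurableSet s → ν s = ∫⁻ t in s, ENNReal.ofReal (u t) ∂μ := by
    intro s hs
    rw [hν, withDensity_apply _ hs]
  obtain ⟨Q, hQ⟩ : ∃ Q : Set T, Q = {t | ENNReal.ofReal (u t) ≠ 0} := ⟨_, rfl⟩
  have hP : MeasurableSet Q := by
    rw [hQ]
    exact (hum (measurableSet_singleton 0)).compl
  have hpos_iff : ∀ s, 0 < ν s ↔ 0 < μ (Q ∩ s) := by
    intro s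
    rw [pos_iff_ne_zero, pos_iff_ne_zero, hν, hQ, Ne, withDensity_apply_eq_zero hum]
  have hnaν : ∀ A : Set T, MeasurableSet A → 0 < ν A →
      ∃ B ⊆ A, MeasurableSet B ∧ 0 < ν B ∧ 0 < ν (A \ B) := by
    intro A hA hpos
    rw [hpos_iff] at hpos
    obtain ⟨A0, hA0, hsub, hp0, hfin⟩ := Measure.exists_subset_measure_lt_top (hP.inter hA) hpos
    obtain ⟨B, hB, hBm, hBp, hBlt⟩ := hna A0 hA0 hp0
    refine ⟨B, hB.trans (hsub.trans inter_subset_right), hBm, ?_, ?_⟩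
    · rw [hpos_iff]
      exact hBp.trans_le (measure_mono fun t ht => ⟨(hsub (hB ht)).1, ht⟩)
    · rw [hpos_iff]
      have h2 : 0 < μ (A0 \ B) := by
        rw [measure_sdiff hB hBm.nullMeasurableSet (hBlt.trans hfin).ne]
        exact tsub_pos_of_lt hBlt
      exact h2.trans_le (measure_mono fun t ht => ⟨(hsub ht.1).1, (hsub ht.1).2, ht.2⟩)
  rw [← happ A hA] at hcA
  obtain ⟨B, hB, hBm, hBc⟩ := aux_sierp ν hnaν A hA c hc hcA
  exact ⟨B, hB, hBm, by rw [← happ B hBm]; exact hBc⟩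

/-- If `μ` is a non-atomic σ-finite measure, `{α_m}` positive reals, and
`{u_m}` non-negative measurable real-valued functions with `∫ u_m dμ ≥ 2^m α_m` for all
`m ≥ 1`, then there are a strictly increasing sequence `{m_n}` of natural numbers and
pairwise disjoint measurable sets `{A_n}` with `∫_{A_n} u_{m_n} dμ = α_{m_n}` for all `n ≥ 1`. -/
theorem disjoint_sets_with_prescribed_integrals
    {T : Type*} [MeasurableSpace T] (μ : Measure T) [SigmaFinite μ]
    (hna : ∀ A : Set T, MeasurableSet A → 0 < μ A →
      ∃ B ⊆ A, MeasurableSet B ∧ 0 < μ B ∧ μ B < μ A)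
    (a : ℕ → ℝ) (hapos : ∀ m, 1 ≤ m → 0 < a m)
    (u : ℕ → T → ℝ) (humeas : ∀ m, Measurable (u m)) (hunn : ∀ m t, 0 ≤ u m t)
    (hint : ∀ m, 1 ≤ m →
      ENNReal.ofReal (2 ^ m * a m) ≤ ∫⁻ t, ENNReal.ofReal (u m t) ∂μ) :
    ∃ (ms : ℕ → ℕ) (A : ℕ → Set T), StrictMono ms ∧ (∀ n, 1 ≤ ms n) ∧
      (∀ n, MeasurableSet (A n)) ∧ Pairwise (Function.onFun Disjoint A) ∧
      ∀ n, ∫⁻ t in A n, ENNReal.ofReal (u (ms n) t) ∂μ = ENNReal.ofReal (a (ms n)) := by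
  let P : Set T → Prop := fun R => ∃ k : ℕ, ∃ᶠ m in atTop,
    ENNReal.ofReal (2 ^ m * a m) ≤ 2 ^ k * ∫⁻ t in R, ENNReal.ofReal (u m t) ∂μ
  have hPmono : ∀ R R' : Set T, R ⊆ R' → P R → P R' := by
    rintro R R' h ⟨k, hk⟩
    refine ⟨k, hk.mono fun m hm => hm.trans ?_⟩
    gcongr
  have step : ∀ s : {p : Set T × ℕ // MeasurableSet p.1 ∧ P p.1}, ∃ q : Set T × ℕ,
      q.1 ⊆ s.1.1 ∧ MeasurableSet q.1 ∧ s.1.2 ≤ q.2 ∧ 1 ≤ q.2 ∧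
      (∫⁻ t in q.1, ENNReal.ofReal (u q.2 t) ∂μ = ENNReal.ofReal (a q.2)) ∧
      P (s.1.1 \ q.1) := by
    rintro ⟨⟨R, N⟩, hR, k, hk⟩
    dsimp only at hR hk ⊢
    obtain ⟨m, hm, hmk⟩ := (frequently_atTop.1 hk) (max N (k + 1))
    have hmN : N ≤ m := (le_max_left _ _).trans hm
    have hmk1 : k + 1 ≤ m := (le_max_right _ _).trans hm
    have hm1 : 1 ≤ m := by omega
    have ham := hapos m hm1
    have h2 : 2 * ENNReal.ofReal (a m) ≤ ∫⁻ t in R, ENNReal.ofReal (u m t) ∂μ := by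
      have h3 : (2 : ℝ≥0∞) ^ k * (2 * ENNReal.ofReal (a m)) ≤
          2 ^ k * ∫⁻ t in R, ENNReal.ofReal (u m t) ∂μ := by
        refine le_trans ?_ hmk
        rw [ENNReal.ofReal_mul (by positivity), ENNReal.ofReal_pow (by norm_num), ← mul_assoc,
          ← pow_succ, ENNReal.ofReal_ofNat]
        gcongr
        norm_num
      exact (ENNReal.mul_le_mul_iff_right (by simp) (by finiteness)).1 h3
    obtain ⟨B, hB, hBm, hBi⟩ := aux_integral μ hna (u m) (humeas m) R hR
      (ENNReal.ofReal (a m)) ENNReal.ofReal_ne_top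
      (le_trans (by rw [two_mul]; exact le_self_add) h2)
    have hsplit : ∀ j, ∫⁻ t in B, ENNReal.ofReal (u j t) ∂μ +
        ∫⁻ t in R \ B, ENNReal.ofReal (u j t) ∂μ = ∫⁻ t in R, ENNReal.ofReal (u j t) ∂μ := by
      intro j
      have := lintegral_inter_add_sdiff (μ := μ) (fun t => ENNReal.ofReal (u j t)) R hBm
      rwa [inter_eq_self_of_subset_right hB] at this
    have hor : P B ∨ P (R \ B) := by
      have : ∃ᶠ j in atTop,
          (ENNReal.ofReal (2 ^ j * a j) ≤ 2 ^ (k + 1) * ∫⁻ t in B, ENNReal.ofReal (u j t) ∂μ) ∨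
          (ENNReal.ofReal (2 ^ j * a j) ≤
            2 ^ (k + 1) * ∫⁻ t in R \ B, ENNReal.ofReal (u j t) ∂μ) := by
        refine hk.mono fun j hj => ?_
        rw [← hsplit j] at hj
        rcases le_total (∫⁻ t in B, ENNReal.ofReal (u j t) ∂μ)
          (∫⁻ t in R \ B, ENNReal.ofReal (u j t) ∂μ) with h | h
        · right
          refine hj.trans ?_
          rw [pow_succ, mul_assoc, two_mul (∫⁻ t in R \ B, ENNReal.ofReal (u j t) ∂μ)]
          gcongr
        · left
          refine hj.trans ?_
          rw [pow_succ, mul_assoc, two_mul (∫⁻ t in B, ENNReal.ofReal (u j t) ∂μ)]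
          gcongr
      rcases frequently_or_distrib.1 this with h | h
      · exact Or.inl ⟨k + 1, h⟩
      · exact Or.inr ⟨k + 1, h⟩
    rcases hor with h | h
    · have h4 : ENNReal.ofReal (a m) ≤ ∫⁻ t in R \ B, ENNReal.ofReal (u m t) ∂μ := by
        rw [← hsplit m, hBi, two_mul] at h2
        exact (ENNReal.add_le_add_iff_left ENNReal.ofReal_ne_top).1 h2
      obtain ⟨C, hC, hCm, hCi⟩ := aux_integral μ hna (u m) (humeas m) (R \ B) (hR.diff hBm)
        (ENNReal.ofReal (a m)) ENNReal.ofReal_ne_top h4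
      exact ⟨(C, m), hC.trans sdiff_subset, hCm, hmN, hm1, hCi,
        hPmono _ _ (fun t ht => ⟨hB ht, fun htC => (hC htC).2 ht⟩) h⟩
    · exact ⟨(B, m), hB, hBm, hmN, hm1, hBi, h⟩
  choose f hf1 hf2 hf3 hf4 hf5 hf6 using step
  have h0 : P univ := by
    refine ⟨0, Eventually.frequently ?_⟩
    filter_upwards [eventually_ge_atTop 1] with m hm
    simpa using hint m hm
  let s : ℕ → {p : Set T × ℕ // MeasurableSet p.1 ∧ P p.1} := fun n =>
    Nat.rec ⟨(univ, 0), MeasurableSet.univ, h0⟩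
      (fun _ x => ⟨(x.1.1 \ (f x).1, (f x).2 + 1), x.2.1.diff (hf2 x), hf6 x⟩) n
  have hs1 : ∀ n, (s (n + 1)).1.1 = (s n).1.1 \ (f (s n)).1 := fun n => rfl
  have hs2 : ∀ n, (s (n + 1)).1.2 = (f (s n)).2 + 1 := fun n => rfl
  have hanti : Antitone (fun n => (s n).1.1) := by
    apply antitone_nat_of_succ_le
    intro n
    rw [hs1]
    exact sdiff_subset
  refine ⟨fun n => (f (s n)).2, fun n => (f (s n)).1, ?_, fun n => hf4 _, fun n => hf2 _, ?_,
    fun n => hf5 _⟩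
  · apply strictMono_nat_of_lt_succ
    intro n
    have := hf3 (s (n + 1))
    rw [hs2] at this
    exact this
  · have hlt : ∀ i j, i < j → Disjoint (f (s i)).1 (f (s j)).1 := by
      intro i j hij
      have h5 : (f (s j)).1 ⊆ (s i).1.1 \ (f (s i)).1 := by
        rw [← hs1]
        exact (hf1 (s j)).trans (hanti hij)
      exact disjoint_sdiff_right.mono_right h5
    intro i j hij
    rcases lt_or_gt_of_ne hij with h | h
    · exact hlt i j h
    · exact (hlt j i h).symm
end

section
/- Let φ be a deformed exponential and let {u_{0,i}}_{i≥1} be a sequence of positive real numbers. Then φ and {u_{0,i}} satisfy condition (C_seq) if, and only if, there exist constants α ∈ (0,1) and ε > 0 and a sequence {c_i} ⊆ ℝ ∪ {−∞} with Σ_{i=1}^∞ φ(c_i) < ∞ (with φ(−∞) = 0) such that for every i ≥ 1 and every real u > c_i with φ(u − u_{0,i}) < ε, one has α·φ(u) ≤ φ(u − u_{0,i}). -/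
open Filter Set

/-- The deformed exponential `φ` extended to `ℝ ∪ {−∞}` (as a subset of `EReal`),
with the convention `φ(−∞) = 0`, valued in `ℝ≥0∞` for summation. -/
noncomputable def phiE (φ : ℝ → ℝ) : EReal → ENNReal :=
  fun x => if x = ⊥ then 0 else ENNReal.ofReal (φ x.toReal)

lemma aux_mono (φ : ℝ → ℝ) (hconv : ConvexOn ℝ Set.univ φ) (hnonneg : ∀ u, 0 ≤ φ u)
    (hbot : Tendsto φ atBot (nhds 0)) : Monotone φ := by
  intro x y hxy
  by_contra! hlt
  have hne : x < y := lt_of_le_of_ne hxy (by rintro rfl; exact lt_irrefl _ hlt)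
  have hz : ∀ᶠ z in atBot, φ x ≤ φ z := by
    filter_upwards [eventually_lt_atBot x] with z hz
    have h := hconv.slope_mono_adjacent (mem_univ z) (mem_univ y) hz hne
    have h1 : (φ y - φ x) / (y - x) ≤ 0 :=
      div_nonpos_of_nonpos_of_nonneg (by linarith) (by linarith)
    by_contra! h2
    have : 0 < (φ x - φ z) / (x - z) := div_pos (by linarith) (by linarith)
    linarith
  have := ge_of_tendsto hbot hz
  have := hnonneg y
  linarith

lemma aux_block (g h : ℕ → ℝ) (δ : ℝ) (hδ : 0 ≤ δ) (hg : ∀ i, 0 ≤ g i) (hns : ¬ Summable g)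
    (h1 : ∀ i, h i ≤ δ) (h2 : ∀ i, h i ≤ δ * g i) (N : ℕ) :
    ∃ M, N ≤ M ∧ 1 ≤ ∑ i ∈ Finset.Ico N M, g i ∧ ∑ i ∈ Finset.Ico N M, h i ≤ 2 * δ := by
  classical
  have ht := (not_summable_iff_tendsto_nat_atTop_of_nonneg hg).1 hns
  have hex : ∃ M, 1 ≤ ∑ i ∈ Finset.Ico N M, g i := by
    obtain ⟨M, hM, hNM⟩ := ((ht.eventually_ge_atTop (1 + ∑ i ∈ Finset.range N, g i)).and
      (eventually_ge_atTop N)).exists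
    refine ⟨M, ?_⟩
    rw [Finset.sum_Ico_eq_sub _ hNM]
    linarith
  have hM := Nat.find_spec hex
  have hmin := fun m => @Nat.find_min _ _ hex m
  generalize Nat.find hex = M at hM hmin
  have hNM : N < M := by
    by_contra! hle
    rw [Finset.Ico_eq_empty_of_le hle] at hM
    norm_num at hM
  refine ⟨M, hNM.le, hM, ?_⟩
  obtain ⟨m, rfl⟩ : ∃ m, M = m + 1 := ⟨M - 1, by omega⟩
  have hm := hmin m (Nat.lt_succ_self m)
  push Not at hm
  rw [Finset.sum_Ico_succ_top (by omega)]
  have : ∑ i ∈ Finset.Ico N m, h i ≤ δ * ∑ i ∈ Finset.Ico N m, g i := by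
    rw [Finset.mul_sum]; exact Finset.sum_le_sum fun i _ => h2 i
  have := h1 m
  nlinarith

lemma aux_iter (φ : ℝ → ℝ) (hmono : Monotone φ) (u₀ : ℕ → ℝ) (hu₀pos : ∀ i, 0 < u₀ i)
    (H : ∀ c : ℕ → ℝ, (∑' i, ENNReal.ofReal (φ (c i)) < ⊤) →
      ∑' i, ENNReal.ofReal (φ (c i + u₀ i)) < ⊤)
    (c : ℕ → ℝ) (hc : ∑' i, ENNReal.ofReal (φ (c i)) < ⊤) (lam : ℝ) :
    ∑' i, ENNReal.ofReal (φ (c i + lam * u₀ i)) < ⊤ := by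
  have key : ∀ n : ℕ, ∑' i, ENNReal.ofReal (φ (c i + n * u₀ i)) < ⊤ := by
    intro n
    induction n with
    | zero => simpa using hc
    | succ n ih =>
      have := H _ ih
      refine lt_of_eq_of_lt ?_ this
      congr 1; ext i; congr 2; push_cast; ring
  obtain ⟨n, hn⟩ := exists_nat_ge lam
  refine lt_of_le_of_lt (ENNReal.tsum_le_tsum fun i => ?_) (key n)
  exact ENNReal.ofReal_le_ofReal (hmono (by nlinarith [hu₀pos i]))

lemma aux_step (φ : ℝ → ℝ) (hmono : Monotone φ) (hnonneg : ∀ u, 0 ≤ φ u) (u₀ : ℕ → ℝ)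
    (α : ℝ) (hα : 0 < α) (ε : ℝ) (hε : 0 < ε) (c : ℕ → EReal) (hct : ∀ i, c i ≠ ⊤)
    (hc : ∑' i, phiE φ (c i) < ⊤)
    (H : ∀ i : ℕ, ∀ u : ℝ, c i < (u : EReal) → φ (u - u₀ i) < ε → α * φ u ≤ φ (u - u₀ i))
    (d : ℕ → ℝ) (hd : ∑' i, ENNReal.ofReal (φ (d i)) < ⊤) :
    ∑' i, ENNReal.ofReal (φ (d i + u₀ i)) < ⊤ := by
  have hds : Summable fun i => φ (d i) := by
    have := ENNReal.summable_toReal hd.ne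
    simpa [ENNReal.toReal_ofReal, hnonneg] using this
  have hcs : Summable fun i => (phiE φ (c i)).toReal := ENNReal.summable_toReal hc.ne
  have hev : ∀ᶠ i in cofinite, φ (d i) < ε :=
    hds.tendsto_cofinite_zero.eventually_lt_const hε
  have hs : Summable fun i => φ (d i + u₀ i) := by
    refine Summable.of_norm_bounded_eventually
      (g := fun i => α⁻¹ * φ (d i) + (phiE φ (c i)).toReal)
      ((hds.mul_left _).add hcs) ?_
    filter_upwards [hev] with i hi
    rw [Real.norm_of_nonneg (hnonneg _)]
    by_cases hlt : c i < ((d i + u₀ i : ℝ) : EReal)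
    · have := H i _ hlt (by simpa using hi)
      rw [add_sub_cancel_right] at this
      have h3 : φ (d i + u₀ i) ≤ α⁻¹ * φ (d i) := by
        rw [inv_mul_eq_div, le_div_iff₀ hα]; linarith
      have := ENNReal.toReal_nonneg (a := phiE φ (c i))
      linarith
    · have hle := not_lt.1 hlt
      have hb : c i ≠ ⊥ := by
        intro h; rw [h] at hlt; exact hlt (EReal.bot_lt_coe _)
      have h4 : d i + u₀ i ≤ (c i).toReal := by
        rw [← EReal.coe_toReal (hct i) hb] at hle
        exact_mod_cast hle
      have h5 : (phiE φ (c i)).toReal = φ (c i).toReal := by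
        simp [phiE, hb, hnonneg]
      have := hmono h4
      have := mul_nonneg (inv_pos.2 hα).le (hnonneg (d i))
      rw [h5]; linarith
  exact lt_top_iff_ne_top.2 hs.tsum_ofReal_ne_top

/-- gluing along disjoint blocks -/
lemma aux_glue (φ : ℝ → ℝ) (hnonneg : ∀ u, 0 ≤ φ u)
    (hbot : Tendsto φ atBot (nhds 0)) (u₀ : ℕ → ℝ)
    (H : ∀ c : ℕ → ℝ, (∑' i, ENNReal.ofReal (φ (c i)) < ⊤) →
      ∑' i, ENNReal.ofReal (φ (c i + u₀ i)) < ⊤)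
    (P : ℕ → ℕ → Prop) (s : ℕ → ℕ → ℝ) (g h : ℕ → ℕ → ℝ)
    (hg : ∀ n i, 0 ≤ g n i) (hh : ∀ n i, 0 ≤ h n i)
    (hgP : ∀ n i, P n i → g n i = φ (s n i)) (hgN : ∀ n i, ¬ P n i → g n i = 0)
    (hhP : ∀ n i, P n i → h n i = φ (s n i - u₀ i))
    (h1 : ∀ n i, h n i ≤ (1 / 2) ^ (n + 1)) (h2 : ∀ n i, h n i ≤ (1 / 2) ^ (n + 1) * g n i)
    (hns : ∀ n, ¬ Summable (g n)) : False := by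
  classical
  have hd : ∀ i : ℕ, ∃ x, φ x < (1 / 2) ^ i := fun i =>
    (hbot.eventually_lt_const (by positivity)).exists
  choose d hd using hd
  have hM := fun n => aux_block (g n) (h n) ((1 / 2) ^ (n + 1)) (by positivity) (hg n) (hns n)
    (h1 n) (h2 n)
  choose M hM1 hM2 hM3 using hM
  let N : ℕ → ℕ := fun n => Nat.rec 0 (fun k x => M k x) n
  have hN : ∀ n, N (n + 1) = M n (N n) := fun n => rfl
  have hNm : Monotone N := monotone_nat_of_le_succ fun n => by rw [hN]; exact hM1 _ _
  have huniq : ∀ i m n, N m ≤ i → i < N (m + 1) → N n ≤ i → i < N (n + 1) → m = n := by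
    intro i m n a b a' b'
    rcases lt_trichotomy m n with h | h | h
    · have := hNm (show m + 1 ≤ n from h); omega
    · exact h
    · have := hNm (show n + 1 ≤ m from h); omega
  let A : ℕ → Finset ℕ := fun n => Finset.Ico (N n) (N (n + 1))
  have hA : ∀ i m n, i ∈ A m → i ∈ A n → m = n := by
    intro i m n hm hn
    simp only [A, Finset.mem_Ico] at hm hn
    exact huniq i m n hm.1 hm.2 hn.1 hn.2
  let c : ℕ → ℝ := fun i =>
    if hx : ∃ n, i ∈ A n ∧ P n i then s hx.choose i - u₀ i else d i
  have hc1 : ∀ i n, i ∈ A n → P n i → c i = s n i - u₀ i := by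
    intro i n hi hP
    have hx : ∃ n, i ∈ A n ∧ P n i := ⟨n, hi, hP⟩
    have : hx.choose = n := hA i _ _ hx.choose_spec.1 hi
    simp only [c, dif_pos hx, this]
  have hc2 : ∀ i, (¬ ∃ n, i ∈ A n ∧ P n i) → c i = d i := fun i hx => by simp only [c, dif_neg hx]
  have swap : ∀ f : ℕ → ℕ → ℝ, (∀ n i, 0 ≤ f n i) →
      ∑' i, ∑' n, (if i ∈ A n then ENNReal.ofReal (f n i) else 0)
      = ∑' n, ENNReal.ofReal (∑ i ∈ A n, f n i) := by
    intro f hf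
    rw [ENNReal.tsum_comm]
    congr 1; ext n
    rw [ENNReal.ofReal_sum_of_nonneg (fun i _ => hf n i), tsum_eq_sum (s := A n)]
    · exact Finset.sum_congr rfl fun i hi => by rw [if_pos hi]
    · intro i hi; rw [if_neg hi]
  have hgeo : Summable fun n : ℕ => (1 / 2 : ℝ) ^ n := summable_geometric_two
  have hfin : ∑' i, ENNReal.ofReal (φ (c i)) < ⊤ := by
    have hle : ∑' i, ENNReal.ofReal (φ (c i)) ≤ ∑' i, (ENNReal.ofReal ((1 / 2) ^ i) +
        ∑' n, (if i ∈ A n then ENNReal.ofReal (h n i) else 0)) := by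
      refine ENNReal.tsum_le_tsum fun i => ?_
      by_cases hx : ∃ n, i ∈ A n ∧ P n i
      · obtain ⟨n, hn, hP⟩ := hx
        rw [hc1 i n hn hP, ← hhP n i hP]
        refine le_trans ?_ le_add_self
        refine le_trans ?_ (ENNReal.le_tsum n)
        rw [if_pos hn]
      · rw [hc2 i hx]
        exact le_trans (ENNReal.ofReal_le_ofReal (hd i).le) le_self_add
    refine lt_of_le_of_lt hle ?_
    rw [ENNReal.tsum_add, swap h hh]
    refine ENNReal.add_lt_top.2 ⟨lt_top_iff_ne_top.2 hgeo.tsum_ofReal_ne_top, ?_⟩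
    refine lt_of_le_of_lt (ENNReal.tsum_le_tsum fun n => ?_)
      (lt_top_iff_ne_top.2 hgeo.tsum_ofReal_ne_top)
    refine ENNReal.ofReal_le_ofReal ((hM3 n (N n)).trans (le_of_eq ?_))
    rw [pow_succ]; ring
  have hinf := H c hfin
  have hge : ∑' i, ∑' n, (if i ∈ A n then ENNReal.ofReal (g n i) else 0) ≤
      ∑' i, ENNReal.ofReal (φ (c i + u₀ i)) := by
    refine ENNReal.tsum_le_tsum fun i => ?_
    by_cases hx : ∃ n, i ∈ A n
    · obtain ⟨n, hn⟩ := hx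
      rw [tsum_eq_single n, if_pos hn]
      · by_cases hP : P n i
        · rw [hgP n i hP, hc1 i n hn hP, sub_add_cancel]
        · rw [hgN n i hP]; simp
      · intro m hm
        rw [if_neg]
        intro h; exact hm (hA i _ _ h hn)
    · push Not at hx
      simp [hx]
  rw [swap g hg] at hge
  have htop : ∑' n, ENNReal.ofReal (∑ i ∈ A n, g n i) = ⊤ := by
    rw [eq_top_iff, ← ENNReal.tsum_const_eq_top_of_ne_zero (α := ℕ) one_ne_zero]
    refine ENNReal.tsum_le_tsum fun n => ?_
    rw [← ENNReal.ofReal_one]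
    exact ENNReal.ofReal_le_ofReal (hM2 n (N n))
  rw [htop] at hge
  exact absurd hinf (not_lt.2 hge)

lemma aux_forward (φ : ℝ → ℝ) (hcont : Continuous φ) (hnonneg : ∀ u, 0 ≤ φ u)
    (hbot : Tendsto φ atBot (nhds 0)) (htop : Tendsto φ atTop atTop) (u₀ : ℕ → ℝ)
    (H : ∀ c : ℕ → ℝ, (∑' i, ENNReal.ofReal (φ (c i)) < ⊤) →
      ∑' i, ENNReal.ofReal (φ (c i + u₀ i)) < ⊤) :
    (∃ α : ℝ, α ∈ Set.Ioo (0 : ℝ) 1 ∧ ∃ ε : ℝ, 0 < ε ∧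
      ∃ c : ℕ → EReal, (∀ i, c i ≠ ⊤) ∧ (∑' i, phiE φ (c i) < ⊤) ∧
        ∀ i : ℕ, ∀ u : ℝ, c i < (u : EReal) → φ (u - u₀ i) < ε →
          α * φ u ≤ φ (u - u₀ i)) := by
  classical
  by_contra hcon
  let S : ℕ → ℕ → Set ℝ := fun n i => {u | φ (u - u₀ i) < (1 / 2) ^ (n + 1) ∧
    φ (u - u₀ i) < (1 / 2) ^ (n + 1) * φ u}
  have hbdd : ∀ n i, BddAbove (S n i) := by
    intro n i
    obtain ⟨B, hB⟩ := eventually_atTop.1 (htop.eventually_ge_atTop ((1 / 2) ^ (n + 1)))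
    refine ⟨B + u₀ i, fun u hu => ?_⟩
    by_contra! hlt
    have := hB (u - u₀ i) (by linarith)
    exact absurd hu.1 (not_lt.2 this)
  have hsup : ∀ n i, (S n i).Nonempty →
      φ (sSup (S n i) - u₀ i) ≤ (1 / 2) ^ (n + 1) ∧
      φ (sSup (S n i) - u₀ i) ≤ (1 / 2) ^ (n + 1) * φ (sSup (S n i)) := by
    intro n i hne
    have hcl : IsClosed {u | φ (u - u₀ i) ≤ (1 / 2) ^ (n + 1) ∧
        φ (u - u₀ i) ≤ (1 / 2) ^ (n + 1) * φ u} := by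
      rw [setOf_and]
      exact IsClosed.inter (isClosed_le (by fun_prop) (by fun_prop))
        (isClosed_le (by fun_prop) (by fun_prop))
    have hsub : S n i ⊆ {u | φ (u - u₀ i) ≤ (1 / 2) ^ (n + 1) ∧
        φ (u - u₀ i) ≤ (1 / 2) ^ (n + 1) * φ u} := fun u hu => ⟨hu.1.le, hu.2.le⟩
    exact closure_minimal hsub hcl (csSup_mem_closure hne (hbdd n i))
  refine aux_glue φ hnonneg hbot u₀ H (fun n i => (S n i).Nonempty) (fun n i => sSup (S n i))
    (fun n i => if (S n i).Nonempty then φ (sSup (S n i)) else 0)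
    (fun n i => if (S n i).Nonempty then φ (sSup (S n i) - u₀ i) else 0)
    ?_ ?_ ?_ ?_ ?_ ?_ ?_ ?_
  · intro n i; split_ifs <;> simp [hnonneg]
  · intro n i; split_ifs <;> simp [hnonneg]
  · intro n i hP; exact if_pos hP
  · intro n i hP; exact if_neg hP
  · intro n i hP; exact if_pos hP
  · intro n i; split_ifs with hP
    · exact (hsup n i hP).1
    · positivity
  · intro n i; split_ifs with hP
    · exact (hsup n i hP).2
    · simp
  · intro n hs
    apply hcon
    refine ⟨(1 / 2) ^ (n + 1), ⟨by positivity, pow_lt_one₀ (by norm_num) (by norm_num) (by omega)⟩,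
      (1 / 2) ^ (n + 1), by positivity,
      fun i => if (S n i).Nonempty then ((sSup (S n i) : ℝ) : EReal) else ⊥, ?_, ?_, ?_⟩
    · intro i; dsimp only; split_ifs <;> simp
    · refine lt_of_eq_of_lt ?_ (lt_top_iff_ne_top.2 hs.tsum_ofReal_ne_top)
      congr 1; ext i
      by_cases hP : (S n i).Nonempty <;> simp [phiE, hP]
    · intro i u hu hlt
      by_contra! hlt2
      have hmem : u ∈ S n i := ⟨hlt, hlt2⟩
      have hne : (S n i).Nonempty := ⟨u, hmem⟩
      dsimp only at hu
      rw [if_pos hne] at hu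
      have := le_csSup (hbdd n i) hmem
      have hu' : sSup (S n i) < u := by exact_mod_cast hu
      linarith

/-- A deformed exponential `φ` and a sequence `{u_{0,i}} ⊂ (0,∞)` satisfy
condition (C_seq) iff there exist `α ∈ (0,1)`, `ε > 0` and a sequence
`{c_i} ⊆ ℝ ∪ {−∞}` with `Σ φ(c_i) < ∞` (with `φ(−∞) = 0`) such that for every `i` and
every real `u > c_i` with `φ(u − u_{0,i}) < ε`, one has `α φ(u) ≤ φ(u − u_{0,i})`. -/
theorem condC_seq_iff_ineq
    (φ : ℝ → ℝ) (hconv : ConvexOn ℝ Set.univ φ) (hnonneg : ∀ u, 0 ≤ φ u)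
    (hbot : Tendsto φ atBot (nhds 0)) (htop : Tendsto φ atTop atTop)
    (u₀ : ℕ → ℝ) (hu₀pos : ∀ i, 0 < u₀ i) :
    (∀ c : ℕ → ℝ, (∑' i, ENNReal.ofReal (φ (c i)) < ⊤) →
      ∀ lam : ℝ, 0 < lam → ∑' i, ENNReal.ofReal (φ (c i + lam * u₀ i)) < ⊤) ↔
    (∃ α : ℝ, α ∈ Set.Ioo (0 : ℝ) 1 ∧ ∃ ε : ℝ, 0 < ε ∧
      ∃ c : ℕ → EReal, (∀ i, c i ≠ ⊤) ∧ (∑' i, phiE φ (c i) < ⊤) ∧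
        ∀ i : ℕ, ∀ u : ℝ, c i < (u : EReal) → φ (u - u₀ i) < ε →
          α * φ u ≤ φ (u - u₀ i)) := by
  have hmono := aux_mono φ hconv hnonneg hbot
  have hcont : Continuous φ := by
    rw [← continuousOn_univ]
    exact hconv.continuousOn isOpen_univ
  constructor
  · intro H
    exact aux_forward φ hcont hnonneg hbot htop u₀ fun c hc => by simpa using H c hc 1 one_pos
  · rintro ⟨α, hα, ε, hε, c, hct, hc, H⟩ d hd lam _
    exact aux_iter φ hmono u₀ hu₀pos
      (aux_step φ hmono hnonneg u₀ α hα.1 ε hε c hct hc H) d hd lam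
end
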